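/- Let V be a finite set of N nodes, let G_1, …, G_k ⊆ V be pairwise disjoint replica groups of size R, and let C ⊆ V with |C| = e be a set of nodes holding MDS coded fragments, disjoint from all G_i, with N ≥ Rk + e. Call a lost set S ⊆ V non-fatal iff #{i : G_i ⊆ S} ≤ |C \ S|. Then for 0 ≤ L ≤ N, the number of non-fatal size-L subsets S ⊆ V equals the sum, over all integer tuples (x_1, …, x_k, y, z) with 0 ≤ x_i ≤ R, 0 ≤ y ≤ e, 0 ≤ z ≤ N−Rk−e, #{i : x_i = 0} ≤ y, and x_1 + … + x_k + y + z = N−L, of (∏_{i=1}^k C(R, x_i)) · C(e, y) · C(N−Rk−e, z); consequently the probability of file loss given L uniformly random lost nodes equals 1 minus this sum divided by C(N,L). (Paper's Theorem 2, HyRES(R,e,0,k).) -/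

import Mathlib

theorem hyres_aux_decomp {α : Type*} [DecidableEq α] (V C : Finset α) (k : ℕ)
    (G : Fin k → Finset α) (hGV : ∀ i, G i ⊆ V) (hCV : C ⊆ V) (S : Finset α) :
    V \ S = (Finset.univ.biUnion (fun i => G i \ S)) ∪ (C \ S) ∪
      ((V \ (Finset.univ.biUnion G ∪ C)) \ S) := by
  ext a
  have h1 : ∀ i, a ∈ G i → a ∈ V := fun i h => hGV i h
  have h2 : a ∈ C → a ∈ V := fun h => hCV h
  simp only [Finset.mem_sdiff, Finset.mem_union, Finset.mem_biUnion, Finset.mem_univ, true_and]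
  constructor
  · rintro ⟨hV, hS⟩
    by_cases hc : a ∈ C
    · exact Or.inl (Or.inr ⟨hc, hS⟩)
    · by_cases hg : ∃ i, a ∈ G i
      · obtain ⟨i, hi⟩ := hg
        exact Or.inl (Or.inl ⟨i, hi, hS⟩)
      · exact Or.inr ⟨⟨hV, by tauto⟩, hS⟩
  · rintro ((⟨i, hi, hS⟩ | ⟨hc, hS⟩) | ⟨⟨hV, _⟩, hS⟩)
    · exact ⟨h1 i hi, hS⟩
    · exact ⟨h2 hc, hS⟩
    · exact ⟨hV, hS⟩

theorem hyres_aux_card {α : Type*} [DecidableEq α] (C W : Finset α) (k : ℕ)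
    (G : Fin k → Finset α) (A : Fin k → Finset α) (B D : Finset α)
    (hGdisj : ∀ i j, i ≠ j → Disjoint (G i) (G j))
    (hGC : ∀ i, Disjoint (G i) C) (hGW : ∀ i, Disjoint (G i) W) (hCW : Disjoint C W)
    (hA : ∀ i, A i ⊆ G i) (hB : B ⊆ C) (hD : D ⊆ W) :
    (Finset.univ.biUnion A ∪ B ∪ D).card = (∑ i, (A i).card) + B.card + D.card := by
  rw [Finset.card_union_of_disjoint, Finset.card_union_of_disjoint, Finset.card_biUnion]
  · intro i _ j _ hij
    exact Finset.disjoint_of_subset_left (hA i) (Finset.disjoint_of_subset_right (hA j) (hGdisj i j hij))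
  · rw [Finset.disjoint_biUnion_left]
    intro i _
    exact Finset.disjoint_of_subset_left (hA i) (Finset.disjoint_of_subset_right hB (hGC i))
  · rw [Finset.disjoint_union_left, Finset.disjoint_biUnion_left]
    exact ⟨fun i _ => Finset.disjoint_of_subset_left (hA i)
      (Finset.disjoint_of_subset_right hD (hGW i)),
      Finset.disjoint_of_subset_left hB (Finset.disjoint_of_subset_right hD hCW)⟩

theorem hyres_aux_recover {α : Type*} [DecidableEq α] (V P X U : Finset α)
    (hPV : P ⊆ V) (hX : X ⊆ P) (hU : Disjoint P (U \ X)) (hXU : X ⊆ U) :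
    P \ (V \ U) = X := by
  ext a
  have h1 := @hPV a
  have h2 := @hX a
  have h3 := @hXU a
  have h4 : a ∈ P → a ∉ U \ X := fun h => Finset.disjoint_left.mp hU h
  simp only [Finset.mem_sdiff] at *
  tauto

theorem hyres_aux_fiber {α : Type*} [DecidableEq α] (V C W : Finset α)
    (R e w L k : ℕ) (G : Fin k → Finset α)
    (hGV : ∀ i, G i ⊆ V) (hCV : C ⊆ V) (hWV : W ⊆ V)
    (hGcard : ∀ i, (G i).card = R) (hCcard : C.card = e) (hWcard : W.card = w)
    (hGdisj : ∀ i j, i ≠ j → Disjoint (G i) (G j))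
    (hGC : ∀ i, Disjoint (G i) C) (hGW : ∀ i, Disjoint (G i) W) (hCW : Disjoint C W)
    (hdec : ∀ S, V \ S = (Finset.univ.biUnion (fun i => G i \ S)) ∪ (C \ S) ∪ (W \ S))
    (hL : L ≤ V.card) (x : Fin k → ℕ) (y z : ℕ)
    (hs : (∑ i, x i) + y + z = V.card - L) :
    ((V.powersetCard L).filter (fun S => (∀ i, (G i \ S).card = x i) ∧
      (C \ S).card = y ∧ (W \ S).card = z)).card
      = (∏ i, R.choose (x i)) * e.choose y * w.choose z := by
  have hr : (∏ i, R.choose (x i)) * e.choose y * w.choose z =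
      ((Fintype.piFinset (fun i => (G i).powersetCard (x i))) ×ˢ
        (C.powersetCard y ×ˢ W.powersetCard z)).card := by
    simp [Finset.card_product, Fintype.card_piFinset, hGcard, hCcard, hWcard, mul_assoc]
  rw [hr]
  refine Finset.card_nbij' (fun S => (fun i => G i \ S, C \ S, W \ S))
    (fun t => V \ (Finset.univ.biUnion t.1 ∪ t.2.1 ∪ t.2.2)) ?_ ?_ ?_ ?_
  · intro S hS
    simp only [Finset.coe_filter, Set.mem_setOf_eq] at hS
    simp [Fintype.mem_piFinset, Finset.mem_powersetCard, hS.2.1, hS.2.2]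
  · rintro ⟨A, B, D⟩ ht
    simp only [Finset.mem_coe, Finset.mem_product, Fintype.mem_piFinset,
      Finset.mem_powersetCard] at ht
    obtain ⟨hA, ⟨hB, hBc⟩, hD, hDc⟩ := ht
    have hA1 := fun i => (hA i).1
    have hc := hyres_aux_card C W k G A B D hGdisj hGC hGW hCW hA1 hB hD
    simp only [(hA _).2, hBc, hDc] at hc
    have hsub : Finset.univ.biUnion A ∪ B ∪ D ⊆ V :=
      Finset.union_subset (Finset.union_subset
        (Finset.biUnion_subset.mpr fun i _ => (hA1 i).trans (hGV i)) (hB.trans hCV)) (hD.trans hWV)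
    have hg : ∀ i, G i \ (V \ (Finset.univ.biUnion A ∪ B ∪ D)) = A i := by
      intro i
      refine hyres_aux_recover V _ _ _ (hGV i) (hA1 i) ?_ ?_
      · rw [Finset.disjoint_left]
        intro a ha hm
        simp only [Finset.mem_sdiff, Finset.mem_union, Finset.mem_biUnion, Finset.mem_univ,
          true_and] at hm
        obtain ⟨(⟨j, hj⟩ | hb) | hd, hn⟩ := hm
        · have : i ≠ j := by rintro rfl; exact hn hj
          exact Finset.disjoint_left.mp (hGdisj i j this) ha (hA1 j hj)
        · exact Finset.disjoint_left.mp (hGC i) ha (hB hb)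
        · exact Finset.disjoint_left.mp (hGW i) ha (hD hd)
      · intro a ha
        simp only [Finset.mem_union, Finset.mem_biUnion, Finset.mem_univ, true_and]
        exact Or.inl (Or.inl ⟨i, ha⟩)
    have hcc : C \ (V \ (Finset.univ.biUnion A ∪ B ∪ D)) = B := by
      refine hyres_aux_recover V _ _ _ hCV hB ?_ ?_
      · rw [Finset.disjoint_left]
        intro a ha hm
        simp only [Finset.mem_sdiff, Finset.mem_union, Finset.mem_biUnion, Finset.mem_univ,
          true_and] at hm
        obtain ⟨(⟨j, hj⟩ | hb) | hd, hn⟩ := hm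
        · exact Finset.disjoint_left.mp (hGC j) (hA1 j hj) ha
        · exact hn hb
        · exact Finset.disjoint_left.mp hCW ha (hD hd)
      · intro a ha
        simp [ha]
    have hw : W \ (V \ (Finset.univ.biUnion A ∪ B ∪ D)) = D := by
      refine hyres_aux_recover V _ _ _ hWV hD ?_ ?_
      · rw [Finset.disjoint_left]
        intro a ha hm
        simp only [Finset.mem_sdiff, Finset.mem_union, Finset.mem_biUnion, Finset.mem_univ,
          true_and] at hm
        obtain ⟨(⟨j, hj⟩ | hb) | hd, hn⟩ := hm
        · exact Finset.disjoint_left.mp (hGW j) (hA1 j hj) ha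
        · exact Finset.disjoint_left.mp hCW (hB hb) ha
        · exact hn hd
      · intro a ha
        simp [ha]
    simp only [Finset.coe_filter, Set.mem_setOf_eq, Finset.mem_powersetCard, hg, hcc, hw]
    refine ⟨⟨Finset.sdiff_subset, ?_⟩, fun i => (hA i).2, hBc, hDc⟩
    rw [Finset.card_sdiff_of_subset hsub, hc, hs]
    omega
  · intro S hS
    simp only [Finset.coe_filter, Set.mem_setOf_eq, Finset.mem_powersetCard] at hS
    dsimp only
    rw [← hdec S, Finset.sdiff_sdiff_eq_self hS.1.1]
  · rintro ⟨A, B, D⟩ ht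
    simp only [Finset.mem_coe, Finset.mem_product, Fintype.mem_piFinset,
      Finset.mem_powersetCard] at ht
    obtain ⟨hA, ⟨hB, hBc⟩, hD, hDc⟩ := ht
    have hA1 := fun i => (hA i).1
    have hg : ∀ i, G i \ (V \ (Finset.univ.biUnion A ∪ B ∪ D)) = A i := by
      intro i
      refine hyres_aux_recover V _ _ _ (hGV i) (hA1 i) ?_ ?_
      · rw [Finset.disjoint_left]
        intro a ha hm
        simp only [Finset.mem_sdiff, Finset.mem_union, Finset.mem_biUnion, Finset.mem_univ,
          true_and] at hm
        obtain ⟨(⟨j, hj⟩ | hb) | hd, hn⟩ := hm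
        · have : i ≠ j := by rintro rfl; exact hn hj
          exact Finset.disjoint_left.mp (hGdisj i j this) ha (hA1 j hj)
        · exact Finset.disjoint_left.mp (hGC i) ha (hB hb)
        · exact Finset.disjoint_left.mp (hGW i) ha (hD hd)
      · intro a ha
        simp only [Finset.mem_union, Finset.mem_biUnion, Finset.mem_univ, true_and]
        exact Or.inl (Or.inl ⟨i, ha⟩)
    have hcc : C \ (V \ (Finset.univ.biUnion A ∪ B ∪ D)) = B := by
      refine hyres_aux_recover V _ _ _ hCV hB ?_ ?_
      · rw [Finset.disjoint_left]
        intro a ha hm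
        simp only [Finset.mem_sdiff, Finset.mem_union, Finset.mem_biUnion, Finset.mem_univ,
          true_and] at hm
        obtain ⟨(⟨j, hj⟩ | hb) | hd, hn⟩ := hm
        · exact Finset.disjoint_left.mp (hGC j) (hA1 j hj) ha
        · exact hn hb
        · exact Finset.disjoint_left.mp hCW ha (hD hd)
      · intro a ha
        simp [ha]
    have hw : W \ (V \ (Finset.univ.biUnion A ∪ B ∪ D)) = D := by
      refine hyres_aux_recover V _ _ _ hWV hD ?_ ?_
      · rw [Finset.disjoint_left]
        intro a ha hm
        simp only [Finset.mem_sdiff, Finset.mem_union, Finset.mem_biUnion, Finset.mem_univ,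
          true_and] at hm
        obtain ⟨(⟨j, hj⟩ | hb) | hd, hn⟩ := hm
        · exact Finset.disjoint_left.mp (hGW j) (hA1 j hj) ha
        · exact Finset.disjoint_left.mp hCW (hB hb) ha
        · exact hn hd
      · intro a ha
        simp [ha]
    simp only [hg, hcc, hw]

/-- **Paper's Theorem 2 (HyRES(R,e,0,k)).**
Let `V` be a finite set of `N` nodes, `G 1, …, G k ⊆ V` pairwise disjoint replica
groups of size `R`, and `C ⊆ V` with `|C| = e` a set of nodes holding MDS coded
fragments, disjoint from all `G i`, with `N ≥ Rk + e`. A lost set `S` is non-fatal iff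
`#{i : G i ⊆ S} ≤ |C \ S|`. Then for `0 ≤ L ≤ N` the number of non-fatal size-`L`
subsets `S ⊆ V` equals the sum, over all tuples `(x 1, …, x k, y, z)` with
`0 ≤ x i ≤ R`, `0 ≤ y ≤ e`, `0 ≤ z ≤ N−Rk−e`, `#{i : x i = 0} ≤ y` and
`∑ x i + y + z = N−L`, of `(∏ i, C(R, x i)) · C(e, y) · C(N−Rk−e, z)`; consequently
the probability of file loss given `L` uniformly random lost nodes equals `1` minus
this sum divided by `C(N,L)`. -/
theorem hyres_l0_file_loss_probability
    {α : Type*} [DecidableEq α] (V : Finset α) (C : Finset α)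
    (N R e L k : ℕ) (G : Fin k → Finset α)
    (hV : V.card = N)
    (hGV : ∀ i, G i ⊆ V) (hCV : C ⊆ V)
    (hGcard : ∀ i, (G i).card = R) (hCcard : C.card = e)
    (hGdisj : ∀ i j, i ≠ j → Disjoint (G i) (G j))
    (hGC : ∀ i, Disjoint (G i) C)
    (hN : R * k + e ≤ N) (hL : L ≤ N) :
    (((V.powersetCard L).filter
        (fun S => (Finset.univ.filter (fun i => G i ⊆ S)).card ≤ (C \ S).card)).card
      = ∑ x ∈ Fintype.piFinset (fun _ : Fin k => Finset.range (R + 1)),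
          ∑ y ∈ Finset.range (e + 1),
            ∑ z ∈ Finset.range (N - R * k - e + 1),
              if (Finset.univ.filter (fun i => x i = 0)).card ≤ y ∧
                  (∑ i, x i) + y + z = N - L
                then (∏ i, R.choose (x i)) * e.choose y * (N - R * k - e).choose z
                else 0) ∧
    ((((V.powersetCard L).filter
        (fun S => ¬ (Finset.univ.filter (fun i => G i ⊆ S)).card ≤ (C \ S).card)).card : ℚ)
          / (N.choose L : ℚ)
      = 1 - ((∑ x ∈ Fintype.piFinset (fun _ : Fin k => Finset.range (R + 1)),
          ∑ y ∈ Finset.range (e + 1),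
            ∑ z ∈ Finset.range (N - R * k - e + 1),
              if (Finset.univ.filter (fun i => x i = 0)).card ≤ y ∧
                  (∑ i, x i) + y + z = N - L
                then (∏ i, R.choose (x i)) * e.choose y * (N - R * k - e).choose z
                else 0 : ℕ) : ℚ) / (N.choose L : ℚ)) := by
  classical
  have hdec := hyres_aux_decomp V C k G hGV hCV
  set W := V \ (Finset.univ.biUnion G ∪ C) with hW
  have hWV : W ⊆ V := Finset.sdiff_subset
  have hGW : ∀ i, Disjoint (G i) W := by
    intro i
    rw [Finset.disjoint_left]
    intro a ha hw
    rw [hW, Finset.mem_sdiff] at hw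
    exact hw.2 (Finset.mem_union_left _ (Finset.mem_biUnion.mpr ⟨i, Finset.mem_univ _, ha⟩))
  have hCW : Disjoint C W := by
    rw [Finset.disjoint_left]
    intro a ha hw
    rw [hW, Finset.mem_sdiff] at hw
    exact hw.2 (Finset.mem_union_right _ ha)
  have hcS : ∀ S, (V \ S).card = (∑ i, (G i \ S).card) + (C \ S).card + (W \ S).card := by
    intro S
    rw [hdec S]
    exact hyres_aux_card C W k G _ _ _ hGdisj hGC hGW hCW (fun i => Finset.sdiff_subset)
      Finset.sdiff_subset Finset.sdiff_subset
  have hWcard : W.card = N - R * k - e := by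
    have h := hcS ∅
    simp only [Finset.sdiff_empty, hGcard, hCcard, hV, Finset.sum_const, Finset.card_univ,
      Fintype.card_fin, smul_eq_mul] at h
    rw [mul_comm k R] at h
    omega
  have key : ((V.powersetCard L).filter
        (fun S => (Finset.univ.filter (fun i => G i ⊆ S)).card ≤ (C \ S).card)).card
      = ∑ x ∈ Fintype.piFinset (fun _ : Fin k => Finset.range (R + 1)),
          ∑ y ∈ Finset.range (e + 1),
            ∑ z ∈ Finset.range (N - R * k - e + 1),
              if (Finset.univ.filter (fun i => x i = 0)).card ≤ y ∧
                  (∑ i, x i) + y + z = N - L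
                then (∏ i, R.choose (x i)) * e.choose y * (N - R * k - e).choose z
                else 0 := by
    have hmaps : ∀ S ∈ (V.powersetCard L).filter
        (fun S => (Finset.univ.filter (fun i => G i ⊆ S)).card ≤ (C \ S).card),
        ((fun i => (G i \ S).card, (C \ S).card, (W \ S).card) : (Fin k → ℕ) × ℕ × ℕ) ∈
        (Fintype.piFinset (fun _ : Fin k => Finset.range (R + 1))) ×ˢ
          (Finset.range (e + 1) ×ˢ Finset.range (N - R * k - e + 1)) := by
      intro S _
      simp only [Finset.mem_product, Fintype.mem_piFinset, Finset.mem_range, Nat.lt_succ_iff]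
      refine ⟨fun i => ?_, ?_, ?_⟩
      · rw [← hGcard i]; exact Finset.card_le_card Finset.sdiff_subset
      · rw [← hCcard]; exact Finset.card_le_card Finset.sdiff_subset
      · rw [← hWcard]; exact Finset.card_le_card Finset.sdiff_subset
    rw [Finset.card_eq_sum_card_fiberwise hmaps, Finset.sum_product]
    refine Finset.sum_congr rfl fun x _ => ?_
    rw [Finset.sum_product]
    refine Finset.sum_congr rfl fun y _ => Finset.sum_congr rfl fun z _ => ?_
    have hz : ∀ S, (∀ i, (G i \ S).card = x i) →
        (Finset.univ.filter (fun i => G i ⊆ S)) = Finset.univ.filter (fun i => x i = 0) := by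
      intro S h
      ext i
      simp [← h i, Finset.sdiff_eq_empty_iff_subset]
    split_ifs with hc
    · rw [← hyres_aux_fiber V C W R e (N - R * k - e) L k G hGV hCV hWV hGcard hCcard hWcard
        hGdisj hGC hGW hCW hdec (hV ▸ hL) x y z (by rw [hV]; exact hc.2)]
      congr 1
      ext S
      simp only [Finset.mem_filter, Prod.mk.injEq, funext_iff]
      constructor
      · rintro ⟨⟨h1, _⟩, h3⟩
        exact ⟨h1, h3⟩
      · rintro ⟨h1, h3⟩
        refine ⟨⟨h1, ?_⟩, h3⟩
        rw [hz S h3.1, h3.2.1]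
        exact hc.1
    · rw [Finset.card_eq_zero, Finset.filter_eq_empty_iff]
      intro S hS heq
      simp only [Prod.mk.injEq, funext_iff] at heq
      rw [Finset.mem_filter, Finset.mem_powersetCard] at hS
      apply hc
      refine ⟨?_, ?_⟩
      · rw [← hz S heq.1, ← heq.2.1]
        exact hS.2
      · have h := hcS S
        rw [Finset.card_sdiff_of_subset hS.1.1, hS.1.2, hV] at h
        simp only [heq.1, heq.2.1, heq.2.2] at h
        exact h.symm
  refine ⟨key, ?_⟩
  rw [← key]
  have hpos : (N.choose L : ℚ) ≠ 0 := by exact_mod_cast (Nat.choose_pos hL).ne'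
  have htot := Finset.card_filter_add_card_filter_not (s := V.powersetCard L)
    (fun S => (Finset.univ.filter (fun i => G i ⊆ S)).card ≤ (C \ S).card)
  rw [Finset.card_powersetCard, hV] at htot
  rw [eq_sub_iff_add_eq, ← add_div, div_eq_one_iff_eq hpos, add_comm]
  exact_mod_cast htot
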